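/- arXiv:1302.4668 — 3 statements merged into one kernel-verified Lean document; each statement's English description precedes it below -/
import Mathlib

section
/- There are exactly 42 words of length 7 over the alphabet {1,2,3} with no two adjacent letters equal that are superpatterns for [3]^3; up to permutation of the three letters these are the seven words 1213121, 1213212, 1231213, 1231231, 1231321, 1232123, 1232132. -/
/-- A word `w` of length `n` over the alphabet `{1,…,d}` (modeled as `Fin d`)
contains the pattern `p` of length `k` if some subsequence of `w` is
order-isomorphic to `p`. -/
def Contains {n k d : ℕ} (w : Fin n → Fin d) (p : Fin k → Fin d) : Prop :=
  ∃ f : Fin k → Fin n, StrictMono f ∧ ∀ a b : Fin k, w (f a) ≤ w (f b) ↔ p a ≤ p b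

/-- A word over a ternary alphabet is a superpattern for `[3]^3` if it contains
every pattern of length 3 over the ternary alphabet. -/
def Superpattern3 {n : ℕ} (w : Fin n → Fin 3) : Prop :=
  ∀ p : Fin 3 → Fin 3, Contains w p

/-- A word is minimal if no two adjacent letters are equal. -/
def MinimalWord {n : ℕ} (w : Fin n → Fin 3) : Prop :=
  ∀ (i : ℕ) (h : i + 1 < n), w ⟨i, Nat.lt_of_succ_lt h⟩ ≠ w ⟨i + 1, h⟩

theorem sublist_ofFn_iff {α : Type*} {m n : ℕ} (q : Fin m → α) (w : Fin n → α) :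
    (List.ofFn q).Sublist (List.ofFn w) ↔
      ∃ f : Fin m → Fin n, StrictMono f ∧ ∀ i, q i = w (f i) := by
  rw [List.sublist_iff_exists_fin_orderEmbedding_get_eq]
  constructor
  · rintro ⟨f, hf⟩
    refine ⟨fun i => (f (i.cast (by simp))).cast (by simp), fun i j hij => ?_, fun i => ?_⟩
    · exact f.strictMono hij
    · have h := hf (i.cast (by simp))
      rw [List.get_ofFn, List.get_ofFn] at h
      exact h
  · rintro ⟨f, hf, h⟩
    refine ⟨OrderEmbedding.ofStrictMono
      (fun i => (f (i.cast (by simp))).cast (by simp)) fun i j hij => hf hij, fun i => ?_⟩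
    rw [List.get_ofFn, List.get_ofFn]
    exact h (i.cast (by simp))

/-- Containment of a pattern, as a sublist order-isomorphic to it. -/
theorem contains_iff_exists_sublist {k n d : ℕ} (w : Fin n → Fin d) (p : Fin k → Fin d) :
    Contains w p ↔ ∃ q : Fin k → Fin d, (∀ a b, q a ≤ q b ↔ p a ≤ p b) ∧
      (List.ofFn q).Sublist (List.ofFn w) := by
  simp only [sublist_ofFn_iff]
  constructor
  · rintro ⟨f, hf, h⟩
    exact ⟨fun i => w (f i), h, f, hf, fun _ => rfl⟩
  · rintro ⟨q, hq, f, hf, h⟩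
    exact ⟨f, hf, fun a b => by rw [← h, ← h, hq]⟩

/-- The words of length 3 over the ternary alphabet, grouped by order-isomorphism class. -/
def patternClasses : List (List (List (Fin 3))) :=
  [[[0, 0, 0], [1, 1, 1], [2, 2, 2]],
    [[0, 0, 1], [0, 0, 2], [1, 1, 2]], [[0, 1, 0], [0, 2, 0], [1, 2, 1]],
    [[1, 0, 0], [2, 0, 0], [2, 1, 1]], [[0, 1, 1], [0, 2, 2], [1, 2, 2]],
    [[1, 0, 1], [2, 0, 2], [2, 1, 2]], [[1, 1, 0], [2, 2, 0], [2, 2, 1]],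
    [[0, 1, 2]], [[0, 2, 1]], [[1, 0, 2]], [[1, 2, 0]], [[2, 0, 1]], [[2, 1, 0]]]

theorem exists_patternClass : ∀ p : Fin 3 → Fin 3, ∃ c ∈ patternClasses, ∀ t ∈ c,
    ∃ q : Fin 3 → Fin 3, (∀ a b, q a ≤ q b ↔ p a ≤ p b) ∧ List.ofFn q = t := by
  decide +kernel

theorem patternClass_complete : ∀ c ∈ patternClasses, ∃ p : Fin 3 → Fin 3,
    ∀ q : Fin 3 → Fin 3, (∀ a b, q a ≤ q b ↔ p a ≤ p b) → List.ofFn q ∈ c := by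
  decide +kernel

theorem superpattern3_iff {n : ℕ} (w : Fin n → Fin 3) :
    Superpattern3 w ↔ ∀ c ∈ patternClasses, ∃ t ∈ c, t.Sublist (List.ofFn w) := by
  simp only [Superpattern3, contains_iff_exists_sublist]
  constructor
  · intro h c hc
    obtain ⟨p, hp⟩ := patternClass_complete c hc
    obtain ⟨q, hq, hw⟩ := h p
    exact ⟨_, hp q hq, hw⟩
  · intro h p
    obtain ⟨c, hc, hp⟩ := exists_patternClass p
    obtain ⟨t, ht, hw⟩ := h c hc
    obtain ⟨q, hq, rfl⟩ := hp t ht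
    exact ⟨q, hq, hw⟩

instance {n : ℕ} (w : Fin n → Fin 3) : Decidable (Superpattern3 w) :=
  decidable_of_iff' _ (superpattern3_iff w)

theorem minimalWord_seven_iff (w : Fin 7 → Fin 3) :
    MinimalWord w ↔ ∀ i : Fin 6, w i.castSucc ≠ w i.succ :=
  ⟨fun h i => h i (by omega), fun h i hi => h ⟨i, by omega⟩⟩

instance (w : Fin 7 → Fin 3) : Decidable (MinimalWord w) :=
  decidable_of_iff' _ (minimalWord_seven_iff w)

/-- One representative for each class of minimal superpatterns of length 7 under permutations
of the letters. -/
def representatives : Finset (Fin 7 → Fin 3) :=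
  {![0, 1, 0, 2, 0, 1, 0], ![0, 1, 0, 2, 1, 0, 1],
    ![0, 1, 2, 0, 1, 0, 2], ![0, 1, 2, 0, 1, 2, 0], ![0, 1, 2, 0, 2, 1, 0],
    ![0, 1, 2, 1, 0, 1, 2], ![0, 1, 2, 1, 0, 2, 1]}

/-- The words obtained from the representatives by permuting the letters. -/
def orbitWords : Finset (Fin 7 → Fin 3) :=
  ((Finset.univ : Finset (Equiv.Perm (Fin 3))) ×ˢ representatives).image fun x i => x.1 (x.2 i)

theorem card_orbitWords : orbitWords.card = 42 := by
  decide +kernel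

theorem mem_orbitWords_of_superpattern3 :
    ∀ a b c d e f g : Fin 3, MinimalWord ![a, b, c, d, e, f, g] →
      Superpattern3 ![a, b, c, d, e, f, g] → ![a, b, c, d, e, f, g] ∈ orbitWords := by
  decide +kernel

theorem superpattern3_of_mem_representatives :
    ∀ π : Equiv.Perm (Fin 3), ∀ v ∈ representatives,
      MinimalWord (fun i => π (v i)) ∧ Superpattern3 (fun i => π (v i)) := by
  decide +kernel

theorem mem_orbitWords_iff (w : Fin 7 → Fin 3) :
    MinimalWord w ∧ Superpattern3 w ↔ w ∈ orbitWords := by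
  constructor
  · have hw : ![w 0, w 1, w 2, w 3, w 4, w 5, w 6] = w := by ext a; fin_cases a <;> rfl
    have h := mem_orbitWords_of_superpattern3 (w 0) (w 1) (w 2) (w 3) (w 4) (w 5) (w 6)
    rw [hw] at h
    exact fun hw' => h hw'.1 hw'.2
  · intro h
    obtain ⟨⟨π, v⟩, hv, rfl⟩ := Finset.mem_image.mp h
    exact superpattern3_of_mem_representatives π v (Finset.mem_product.mp hv).2

/-- There are exactly 42 minimal superpatterns of length 7; up to a permutation of
the three letters they are the seven words
`1213121, 1213212, 1231213, 1231231, 1231321, 1232123, 1232132`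
(encoded with letters `0,1,2`). -/
theorem minimal_superpatterns_length_seven :
    Nat.card {w : Fin 7 → Fin 3 // MinimalWord w ∧ Superpattern3 w} = 42 ∧
    ∀ w : Fin 7 → Fin 3,
      (MinimalWord w ∧ Superpattern3 w) ↔
        ∃ π : Equiv.Perm (Fin 3), ∃ v ∈ ({![0, 1, 0, 2, 0, 1, 0], ![0, 1, 0, 2, 1, 0, 1],
          ![0, 1, 2, 0, 1, 0, 2], ![0, 1, 2, 0, 1, 2, 0], ![0, 1, 2, 0, 2, 1, 0],
          ![0, 1, 2, 1, 0, 1, 2], ![0, 1, 2, 1, 0, 2, 1]} : Set (Fin 7 → Fin 3)),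
          w = fun i => π (v i) := by
  constructor
  · simp only [mem_orbitWords_iff]
    rw [Nat.card_eq_finsetCard, card_orbitWords]
  · intro w
    rw [mem_orbitWords_iff]
    simp only [orbitWords, representatives, Finset.mem_image, Finset.mem_product, Finset.mem_univ,
      true_and, Prod.exists, Finset.mem_insert, Finset.mem_singleton, Set.mem_insert_iff,
      Set.mem_singleton_iff, @eq_comm _ w]
end

section
/- Let n ≥ 8 and let σ be a word of length n over {1,2,3} with no two adjacent letters equal, such that σ is a superpattern for [3]^3 but the prefix of σ of length n−1 is not a superpattern for [3]^3 (i.e., σ is a strict minimal superpattern). Then there exist indices i₁ < i₂ < … < i₇ = n such that the length-7 word σ(i₁)σ(i₂)…σ(i₇) is itself a superpattern for [3]^3; that is, σ contains a minimum superpattern whose last letter occurs at the last letter of σ. -/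
theorem contains_of_triple {n d : ℕ} {w : Fin n → Fin d} {p : Fin 3 → Fin d} {i j k : Fin n}
    (hij : i < j) (hjk : j < k) (hi : w i = p 0) (hj : w j = p 1) (hk : w k = p 2) :
    Contains w p := by
  refine ⟨![i, j, k], ?_, ?_⟩
  · rw [Fin.strictMono_iff_lt_succ]
    intro a
    fin_cases a <;> simpa
  · intro a b
    fin_cases a <;> fin_cases b <;> simp [hi, hj, hk]

theorem Contains.of_orderIso {n k d : ℕ} {w : Fin n → Fin d} {p q : Fin k → Fin d}
    (h : Contains w q) (hpq : ∀ a b, q a ≤ q b ↔ p a ≤ p b) : Contains w p := by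
  obtain ⟨f, hf, hw⟩ := h
  exact ⟨f, hf, fun a b => (hw a b).trans (hpq a b)⟩

theorem Contains.of_comp {n m k d : ℕ} {w : Fin n → Fin d} {p : Fin k → Fin d} {g : Fin m → Fin n}
    (hg : StrictMono g) (h : Contains (w ∘ g) p) : Contains w p := by
  obtain ⟨f, hf, hw⟩ := h
  exact ⟨g ∘ f, hg.comp hf, hw⟩

theorem superpattern3_of_triples {n : ℕ} {w : Fin n → Fin 3}
    (h : ∀ p₀ p₁ p₂ : Fin 3, ∃ i j k, i < j ∧ j < k ∧
      (w i ≤ w j ↔ p₀ ≤ p₁) ∧ (w j ≤ w i ↔ p₁ ≤ p₀) ∧ (w i ≤ w k ↔ p₀ ≤ p₂) ∧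
      (w k ≤ w i ↔ p₂ ≤ p₀) ∧ (w j ≤ w k ↔ p₁ ≤ p₂) ∧ (w k ≤ w j ↔ p₂ ≤ p₁)) :
    Superpattern3 w := by
  intro p
  obtain ⟨i, j, k, hij, hjk, h₁, h₂, h₃, h₄, h₅, h₆⟩ := h (p 0) (p 1) (p 2)
  refine Contains.of_orderIso (q := ![w i, w j, w k])
    (contains_of_triple hij hjk rfl rfl rfl) fun a b => ?_
  fin_cases a <;> fin_cases b <;> simp [*]

/-- In a superpattern, all three distinct letters occur in each of the six orders. -/
theorem Superpattern3.exists_triple {n : ℕ} {w : Fin n → Fin 3} (h : Superpattern3 w)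
    {a b c : Fin 3} (hab : a ≠ b) (hac : a ≠ c) (hbc : b ≠ c) :
    ∃ i j k, i < j ∧ j < k ∧ w i = a ∧ w j = b ∧ w k = c := by
  obtain ⟨f, hf, hw⟩ := h ![a, b, c]
  have h₀₁ := hw 0 1
  have h₁₀ := hw 1 0
  have h₀₂ := hw 0 2
  have h₂₀ := hw 2 0
  have h₁₂ := hw 1 2
  have h₂₁ := hw 2 1
  refine ⟨f 0, f 1, f 2, hf (by decide), hf (by decide), ?_⟩
  simp only [Matrix.cons_val] at h₀₁ h₁₀ h₀₂ h₂₀ h₁₂ h₂₁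
  omega

theorem superpattern3_minimum_words (x y z : Fin 3) (hxy : x ≠ y) (hxz : x ≠ z) (hyz : y ≠ z) :
    Superpattern3 ![x, z, y, x, z, y, x] ∧ Superpattern3 ![z, x, y, x, z, y, x] ∧
    Superpattern3 ![z, y, x, y, z, y, x] ∧ Superpattern3 ![z, y, x, z, y, z, x] ∧
    Superpattern3 ![x, z, x, y, x, z, x] ∧ Superpattern3 ![z, x, z, y, x, z, x] ∧
    Superpattern3 ![x, z, y, x, y, z, x] := by
  refine ⟨?_, ?_, ?_, ?_, ?_, ?_, ?_⟩ <;> apply superpattern3_of_triples <;>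
    revert x y z <;> decide +kernel

theorem exists_embedding_of_positions {n : ℕ} {w : Fin n → Fin 3} {a b c d e f g : Fin n}
    (hab : a < b) (hbc : b < c) (hcd : c < d) (hde : d < e) (hef : e < f) (hfg : f < g)
    (h : Superpattern3 ![w a, w b, w c, w d, w e, w f, w g]) :
    ∃ φ : Fin 7 → Fin n, StrictMono φ ∧ φ 6 = g ∧ Superpattern3 (w ∘ φ) := by
  refine ⟨![a, b, c, d, e, f, g], ?_, rfl, ?_⟩
  · rw [Fin.strictMono_iff_lt_succ]
    intro i
    fin_cases i <;> simpa
  · convert h using 1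
    ext i
    fin_cases i <;> rfl

/-- If all six orders of three distinct letters occur up to position `l`, while `y z x` does not
occur strictly before `l`, then some seven letters ending at `l` form a superpattern. -/
theorem exists_minimum_ending_at {n : ℕ} {w : Fin n → Fin 3} {l : Fin n}
    (hall : ∀ a b c : Fin 3, a ≠ b → a ≠ c → b ≠ c →
      ∃ i j k, i < j ∧ j < k ∧ k ≤ l ∧ w i = a ∧ w j = b ∧ w k = c)
    {x y z : Fin 3} (hyz : y ≠ z) (hyx : y ≠ x) (hzx : z ≠ x)
    (hmiss : ∀ i j k, i < j → j < k → k < l → w i = y → w j = z → w k ≠ x) :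
    ∃ φ : Fin 7 → Fin n, StrictMono φ ∧ φ 6 = l ∧ Superpattern3 (w ∘ φ) := by
  have hl : w l = x := by
    obtain ⟨i, j, k, hij, hjk, hkl, hi, hj, hk⟩ := hall y z x hyz hyx hzx
    rcases hkl.eq_or_lt with rfl | hkl
    · exact hk
    · exact absurd hk (hmiss i j k hij hjk hkl hi hj)
  have hpre : ∀ a b c : Fin 3, a ≠ b → a ≠ c → b ≠ c → c ≠ x →
      ∃ i j k, i < j ∧ j < k ∧ k < l ∧ w i = a ∧ w j = b ∧ w k = c := by
    intro a b c hab hac hbc hcx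
    obtain ⟨i, j, k, hij, hjk, hkl, hi, hj, hk⟩ := hall a b c hab hac hbc
    refine ⟨i, j, k, hij, hjk, hkl.lt_of_ne ?_, hi, hj, hk⟩
    rintro rfl
    exact hcx (hk.symm.trans hl)
  obtain ⟨z₁, x₁, y₁, hz₁x₁, hx₁y₁, hy₁l, wz₁, wx₁, wy₁⟩ :=
    hpre z x y hzx hyz.symm hyx.symm hyx
  obtain ⟨y₂, x₂, z₂, hy₂x₂, hx₂z₂, hz₂l, wy₂, wx₂, wz₂⟩ :=
    hpre y x z hyx hyz hzx.symm hzx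
  obtain ⟨x₃, y₃, z₃, hx₃y₃, hy₃z₃, hz₃l, wx₃, wy₃, wz₃⟩ :=
    hpre x y z hyx.symm hzx.symm hyz hzx
  obtain ⟨x₄, z₄, y₄, hx₄z₄, hz₄y₄, hy₄l, wx₄, wz₄, wy₄⟩ :=
    hpre x z y hzx.symm hyx.symm hyz.symm hyx
  obtain ⟨W₁, W₂, W₃, W₄, W₅, W₆, W₇⟩ := superpattern3_minimum_words x y z hyx.symm hzx.symm hyz
  have lt_or_gt : ∀ {i j : Fin n}, w i ≠ w j → i < j ∨ j < i := fun h =>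
    lt_or_gt_of_ne fun e => h (congrArg w e)
  have hz₁y₂ : z₁ < y₂ := by
    refine (lt_or_gt (by rwa [wz₁, wy₂, ne_comm])).resolve_right fun h => ?_
    exact hmiss y₂ z₁ x₁ h hz₁x₁ (hx₁y₁.trans hy₁l) wy₂ wz₁ wx₁
  have late_y : ∀ x' y', x' < y₂ → w x' = x → z₂ < y' → y' < l → w y' = y →
      ∃ φ : Fin 7 → Fin n, StrictMono φ ∧ φ 6 = l ∧ Superpattern3 (w ∘ φ) := by
    intro x' y' hx' wx' hy' hy'l wy'
    rcases lt_or_gt (i := x') (j := z₁) (by rwa [wx', wz₁, ne_comm]) with h | h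
    · exact exists_embedding_of_positions h hz₁y₂ hy₂x₂ hx₂z₂ hy' hy'l
        (by rwa [wx', wz₁, wy₂, wx₂, wz₂, wy', hl])
    · exact exists_embedding_of_positions h hx' hy₂x₂ hx₂z₂ hy' hy'l
        (by rwa [wx', wz₁, wy₂, wx₂, wz₂, wy', hl])
  rcases lt_or_gt (i := y₄) (j := z₂) (by rwa [wy₄, wz₂]) with hy₄ | hy₄
  · rcases lt_or_gt (i := z₄) (j := y₂) (by rwa [wz₄, wy₂, ne_comm]) with hz₄ | hz₄
    · rcases lt_or_gt (i := y₁) (j := z₂) (by rwa [wy₁, wz₂]) with hy₁ | hy₁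
      · rcases lt_or_gt (i := x₁) (j := y₂) (by rwa [wx₁, wy₂, ne_comm]) with hx₁ | hx₁
        · rcases lt_or_gt (i := z₄) (j := x₁) (by rwa [wz₄, wx₁]) with h | h
          · exact exists_embedding_of_positions hx₄z₄ h hx₁ hy₂x₂ hx₂z₂ hz₂l
              (by rwa [wx₄, wz₄, wx₁, wy₂, wx₂, wz₂, hl])
          · exact exists_embedding_of_positions hz₁x₁ h hz₄ hy₂x₂ hx₂z₂ hz₂l
              (by rwa [wz₁, wx₁, wz₄, wy₂, wx₂, wz₂, hl])
        · exact exists_embedding_of_positions hx₄z₄ hz₄ hx₁ hx₁y₁ hy₁ hz₂l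
            (by rwa [wx₄, wz₄, wy₂, wx₁, wy₁, wz₂, hl])
      · exact late_y x₄ y₁ (hx₄z₄.trans hz₄) wx₄ hy₁ hy₁l wy₁
    · have hx₂z₄ : x₂ < z₄ := by
        refine (lt_or_gt (by rwa [wx₂, wz₄, ne_comm])).resolve_right fun h => ?_
        exact hmiss y₂ z₄ x₂ hz₄ h (hx₂z₂.trans hz₂l) wy₂ wz₄ wx₂
      exact exists_embedding_of_positions hz₁y₂ hy₂x₂ hx₂z₄ hz₄y₄ hy₄ hz₂l
        (by rwa [wz₁, wy₂, wx₂, wz₄, wy₄, wz₂, hl])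
  · rcases lt_or_gt (i := x₃) (j := y₂) (by rwa [wx₃, wy₂, ne_comm]) with hx₃ | hx₃
    · exact late_y x₃ y₄ hx₃ wx₃ hy₄ hy₄l wy₄
    · rcases lt_or_gt (i := y₃) (j := z₂) (by rwa [wy₃, wz₂]) with hy₃ | hy₃
      · exact exists_embedding_of_positions hz₁y₂ hx₃ hx₃y₃ hy₃ hy₄ hy₄l
          (by rwa [wz₁, wy₂, wx₃, wy₃, wz₂, wy₄, hl])
      · exact exists_embedding_of_positions hz₁y₂ hy₂x₂ hx₂z₂ hy₃ hy₃z₃ hz₃l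
          (by rwa [wz₁, wy₂, wx₂, wz₂, wy₃, wz₃, hl])

/-- Over a ternary alphabet, the six permutations force all patterns of length three. -/
theorem superpattern3_of_permutations {n : ℕ} {w : Fin n → Fin 3}
    (h : ∀ a b c : Fin 3, a ≠ b → a ≠ c → b ≠ c →
      ∃ i j k, i < j ∧ j < k ∧ w i = a ∧ w j = b ∧ w k = c) :
    Superpattern3 w := by
  classical
  let P : ℕ → Prop := fun m => ∀ a b c : Fin 3, a ≠ b → a ≠ c → b ≠ c →
    ∃ i j k : Fin n, i < j ∧ j < k ∧ k.val ≤ m ∧ w i = a ∧ w j = b ∧ w k = c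
  have hP : ∃ m, P m := by
    refine ⟨n, fun a b c hab hac hbc => ?_⟩
    obtain ⟨i, j, k, hij, hjk, hw⟩ := h a b c hab hac hbc
    exact ⟨i, j, k, hij, hjk, k.isLt.le, hw⟩
  obtain ⟨m, hm, hmin⟩ : ∃ m, P m ∧ ∀ m' < m, ¬ P m' :=
    ⟨Nat.find hP, Nat.find_spec hP, fun _ => Nat.find_min hP⟩
  have hm₀ : 0 < m := by
    obtain ⟨i, j, k, hij, hjk, hk, -⟩ := hm 0 1 2 (by decide) (by decide) (by decide)
    omega
  have hpred := hmin (m - 1) (by omega)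
  simp only [P] at hpred
  push Not at hpred
  obtain ⟨y, z, x, hyz, hyx, hzx, hmiss⟩ := hpred
  have hmn : m < n := by
    obtain ⟨i, j, k, hij, hjk, hk, hi, hj, hk'⟩ := hm y z x hyz hyx hzx
    by_contra hmn
    exact hmiss i j k hij hjk (by omega) hi hj hk'
  obtain ⟨φ, hφ, -, hsup⟩ := exists_minimum_ending_at (l := ⟨m, hmn⟩) hm hyz hyx hzx
    fun i j k hij hjk hk => hmiss i j k hij hjk (Nat.le_sub_one_of_lt hk)
  exact fun p => (hsup p).of_comp hφ

/-- Any strict minimal superpattern `σ` of length `n ≥ 8` contains a minimum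
(length-7) superpattern whose last letter occurs at the last letter of `σ`. -/
theorem strict_minimal_contains_minimum_at_end {n : ℕ} (hn : 8 ≤ n)
    (σ : Fin n → Fin 3) (hmin : MinimalWord σ) (hsup : Superpattern3 σ)
    (hstrict : ¬ Superpattern3 (fun i : Fin (n - 1) => σ (Fin.castLE (Nat.sub_le n 1) i))) :
    ∃ f : Fin 7 → Fin n, StrictMono f ∧ (f 6 : ℕ) = n - 1 ∧ Superpattern3 (σ ∘ f) := by
  have hn₀ : n - 1 < n := by omega
  have hperm : ¬ ∀ a b c : Fin 3, a ≠ b → a ≠ c → b ≠ c → ∃ i j k, i < j ∧ j < k ∧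
      σ (Fin.castLE (Nat.sub_le n 1) i) = a ∧ σ (Fin.castLE (Nat.sub_le n 1) j) = b ∧
      σ (Fin.castLE (Nat.sub_le n 1) k) = c :=
    fun h => hstrict (superpattern3_of_permutations h)
  push Not at hperm
  obtain ⟨y, z, x, hyz, hyx, hzx, hmiss⟩ := hperm
  obtain ⟨φ, hφ, hlast, h⟩ := exists_minimum_ending_at (w := σ) (l := ⟨n - 1, hn₀⟩)
    (fun a b c hab hac hbc => by
      obtain ⟨i, j, k, hij, hjk, hw⟩ := hsup.exists_triple hab hac hbc
      exact ⟨i, j, k, hij, hjk, Nat.le_sub_one_of_lt k.isLt, hw⟩)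
    hyz hyx hzx
    fun i j k hij hjk hk => hmiss ⟨i, (hij.trans hjk).trans hk⟩ ⟨j, hjk.trans hk⟩ ⟨k, hk⟩ hij hjk
  exact ⟨φ, hφ, congrArg Fin.val hlast, h⟩
end

section
/- For every integer d ≥ 3, there exists a word of length d^2 − 2d + 4 over the alphabet {1,…,d} that contains every pattern p : {1,…,d} → {1,…,d} as an order-isomorphic subsequence; that is, n(d,d) ≤ d^2 − 2d + 4. -/
/-- The letters of the superpattern word on `m + 1` letters are indexed increasingly by keys: the
even keys carry the top letter `m`, the odd keys carry `0, …, m - 1` cyclically. `topKey m k` is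
the key of the `k`-th occurrence of the top letter. -/
def topKey (m k : ℕ) : ℕ := if k = 0 then 0 else 2 * (k * (m - 1)) + 2

/-- The set of all keys of the superpattern word. -/
def keySet (m : ℕ) : Finset ℕ :=
  (Finset.range (m + 1)).image (topKey m) ∪
    (Finset.range (m * (m - 1) + 2)).image fun t => 2 * t + 1

/-- The letter carried by a key. -/
def keyLetter (m s : ℕ) : ℕ := if s % 2 = 0 then m else (s / 2) % m

/-- The number of the pass through the cyclic letters `0, …, m - 1` in which the greedy embedding
places the `k`-th letter of `q`. -/
def cyclePass (m : ℕ) (q : ℕ → ℕ) : ℕ → ℕ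
  | 0 => 0
  | k + 1 =>
    if q k = m then (if m + 1 ≤ q (k + 1) + k then k - 1 else k)
    else cyclePass m q k + (if q (k + 1) ≤ q k then 1 else 0)

/-- The key to which the greedy embedding sends the `k`-th letter of `q`. -/
def greedyKey (m : ℕ) (q : ℕ → ℕ) (k : ℕ) : ℕ :=
  if q k = m then topKey m k else 2 * (q k + m * cyclePass m q k) + 1

theorem topKey_even (m k : ℕ) : topKey m k % 2 = 0 := by
  unfold topKey; split_ifs <;> omega

theorem topKey_lt_succ {m : ℕ} (hm : 2 ≤ m) (k : ℕ) : topKey m k < topKey m (k + 1) := by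
  obtain ⟨n, rfl⟩ : ∃ n, m = n + 1 := ⟨m - 1, by omega⟩
  unfold topKey
  rcases k with _ | k
  · simp
  · simp only [Nat.add_sub_cancel, Nat.add_mul, Nat.one_mul, Nat.add_eq_zero_iff, one_ne_zero,
      and_false, if_false]
    omega

theorem card_keySet {m : ℕ} (hm : 2 ≤ m) : (keySet m).card = m * (m - 1) + m + 3 := by
  unfold keySet
  rw [Finset.card_union_of_disjoint, Finset.card_image_of_injective,
    Finset.card_image_of_injective, Finset.card_range, Finset.card_range]
  · omega
  · intro a b h
    simp only at h
    omega
  · exact (strictMono_nat_of_lt_succ (topKey_lt_succ hm)).injective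
  · rw [Finset.disjoint_left]
    intro a ha hb
    obtain ⟨k, -, rfl⟩ := Finset.mem_image.1 ha
    obtain ⟨t, -, ht⟩ := Finset.mem_image.1 hb
    have := topKey_even m k
    omega

theorem keyLetter_le {m : ℕ} (hm : 2 ≤ m) (s : ℕ) : keyLetter m s ≤ m := by
  unfold keyLetter
  split_ifs
  · exact le_rfl
  · exact (Nat.mod_lt _ (by omega)).le

theorem keyLetter_greedyKey {m : ℕ} {q : ℕ → ℕ} {k : ℕ} (hq : q k ≤ m) :
    keyLetter m (greedyKey m q k) = q k := by
  unfold greedyKey keyLetter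
  split_ifs with h1 h2 h2
  · exact h1.symm
  · exact absurd (topKey_even m k) h2
  · omega
  · rw [show (2 * (q k + m * cyclePass m q k) + 1) / 2 = q k + m * cyclePass m q k by omega,
      Nat.add_mul_mod_self_left, Nat.mod_eq_of_lt (by omega)]

theorem cyclePass_le (m : ℕ) (q : ℕ → ℕ) (k : ℕ) : cyclePass m q k ≤ k := by
  induction k with
  | zero => simp [cyclePass]
  | succ k ih => unfold cyclePass; split_ifs <;> omega

theorem cyclePass_lt {m : ℕ} {q : ℕ → ℕ} {a k : ℕ} (ha : q a = m) (hk : a < k) :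
    cyclePass m q k < k := by
  induction k, hk using Nat.le_induction with
  | base => unfold cyclePass; split_ifs <;> omega
  | succ k _ ih => unfold cyclePass; split_ifs <;> omega

theorem antitone_of_cyclePass_eq {m : ℕ} {q : ℕ → ℕ} {k : ℕ} (hq : ∀ i < k, q i ≠ m)
    (h : cyclePass m q k = k) : ∀ i < k, q (i + 1) ≤ q i := by
  induction k with
  | zero => intro i hi; omega
  | succ k ih =>
    have h1 := hq k (by omega)
    have h2 := cyclePass_le m q k
    unfold cyclePass at h
    rw [if_neg h1] at h
    split_ifs at h with h3
    · intro i hi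
      rcases Nat.lt_succ_iff_lt_or_eq.1 hi with h4 | rfl
      · exact ih (fun i hi => hq i (by omega)) (by omega) i h4
      · exact h3
    · omega

theorem antitone_of_cyclePass_succ_eq {m : ℕ} {q : ℕ → ℕ} {a k : ℕ} (ha : q a = m)
    (hk : a < k) (hqa : q (a + 1) ≤ m)
    (hq : ∀ i, a < i → i < k → q i ≠ m) (h : cyclePass m q k + 1 = k) :
    q (a + 1) + a ≤ m ∧ ∀ i, a < i → i < k → q (i + 1) ≤ q i := by
  induction k, hk using Nat.le_induction with
  | base =>
    refine ⟨?_, fun i _ _ => by omega⟩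
    unfold cyclePass at h
    split_ifs at h
    · omega
    · omega
  | succ k hk ih =>
    have h1 := hq k (by omega) (by omega)
    have h2 := cyclePass_lt ha hk
    unfold cyclePass at h
    rw [if_neg h1] at h
    split_ifs at h with h3
    · obtain ⟨h4, h5⟩ := ih (fun i h h' => hq i h (by omega)) (by omega)
      refine ⟨h4, fun i h6 h7 => ?_⟩
      rcases Nat.lt_succ_iff_lt_or_eq.1 h7 with h8 | rfl
      · exact h5 i h6 h8
      · exact h3
    · omega

/-- The greedy embedding is increasing, provided that a weakly decreasing initial segment
preceding the first top letter `q a = m` ends low enough. -/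
theorem greedyKey_lt_succ {m : ℕ} (hm : 2 ≤ m) {q : ℕ → ℕ} (hq : ∀ k ≤ m, q k ≤ m) {a : ℕ}
    (ha : q a = m) (hlt : ∀ k < a, q k ≠ m)
    (hpre : ∀ k, a = k + 1 → (∀ i < k, q (i + 1) ≤ q i) → q k + a ≤ m)
    {k : ℕ} (hk : k < m) : greedyKey m q k < greedyKey m q (k + 1) := by
  have hk0 := hq k hk.le
  have hk1 := hq (k + 1) hk
  unfold greedyKey
  by_cases h1 : q k = m
  · rw [if_pos h1]
    by_cases h2 : q (k + 1) = m
    · rw [if_pos h2]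
      exact topKey_lt_succ hm k
    · rw [if_neg h2, cyclePass, if_pos h1]
      unfold topKey
      obtain ⟨n, rfl⟩ : ∃ n, m = n + 1 := ⟨m - 1, by omega⟩
      rcases k with _ | k
      · simp
      · simp only [Nat.add_sub_cancel]
        split_ifs <;> grind
  · rw [if_neg h1]
    by_cases h2 : q (k + 1) = m
    · rw [if_pos h2]
      have key : q k + m * cyclePass m q k ≤ (k + 1) * (m - 1) := by
        obtain ⟨n, rfl⟩ : ∃ n, m = n + 1 := ⟨m - 1, by omega⟩
        simp only [Nat.add_sub_cancel]
        rcases (cyclePass_le (n + 1) q k).lt_or_eq with h3 | h3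
        · have : (n + 1) * (cyclePass (n + 1) q k + 1) ≤ (n + 1) * k := Nat.mul_le_mul_left _ h3
          grind
        · rcases lt_trichotomy a (k + 1) with h4 | h4 | h4
          · have : a ≠ k := by rintro rfl; exact h1 ha
            have := cyclePass_lt ha (show a < k by omega)
            omega
          · have := hpre k h4 (antitone_of_cyclePass_eq (fun i hi => hlt i (by omega)) h3)
            rw [h3]
            grind
          · exact absurd h2 (hlt _ h4)
      simp only [topKey, Nat.add_eq_zero_iff, one_ne_zero, and_false, if_false]
      omega
    · rw [if_neg h2, cyclePass, if_neg h1]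
      rw [Nat.mul_add m]
      split_ifs
      · omega
      · omega

/-- The greedy embedding stays within the word, provided that a weakly decreasing final segment
following the last top letter `q b = m` starts high enough or ends low enough. -/
theorem greedyKey_last_le {m : ℕ} (hm : 2 ≤ m) {q : ℕ → ℕ} (hq : ∀ k ≤ m, q k ≤ m) {b : ℕ}
    (hb : q b = m) (hbm : b ≤ m) (hlt : ∀ k, b < k → k ≤ m → q k ≠ m)
    (hsuf : b < m → (∀ i, b < i → i < m → q (i + 1) ≤ q i) → q (b + 1) + b ≤ m → q m ≤ 1) :
    greedyKey m q m ≤ 2 * (m * (m - 1) + 1) + 1 := by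
  unfold greedyKey
  split_ifs with h
  · simp only [topKey]
    split_ifs <;> omega
  · have h1 : b < m := lt_of_le_of_ne hbm (by rintro rfl; exact h hb)
    have h2 := cyclePass_lt hb h1
    have key : q m + m * cyclePass m q m ≤ m * (m - 1) + 1 := by
      by_cases h3 : cyclePass m q m + 1 = m
      · obtain ⟨h4, h5⟩ :=
          antitone_of_cyclePass_succ_eq hb h1 (hq _ h1) (fun i h h' => hlt i h h'.le) h3
        have := hsuf h1 h5 h4
        rw [show cyclePass m q m = m - 1 by omega]
        omega
      · have : m * (cyclePass m q m + 1) ≤ m * (m - 1) := Nat.mul_le_mul_left _ (by omega)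
        rw [Nat.mul_add] at this
        have := hq m le_rfl
        omega
    omega

theorem greedyKey_mem_keySet {m : ℕ} {q : ℕ → ℕ} {k : ℕ} (hk : k ≤ m)
    (h : greedyKey m q k ≤ 2 * (m * (m - 1) + 1) + 1) : greedyKey m q k ∈ keySet m := by
  unfold greedyKey at h ⊢
  unfold keySet
  split_ifs at h ⊢
  · exact Finset.mem_union_left _ (Finset.mem_image_of_mem _ (Finset.mem_range.2 (by omega)))
  · exact Finset.mem_union_right _ (Finset.mem_image.2 ⟨_, Finset.mem_range.2 (by omega), rfl⟩)

theorem card_le_of_forall_exists_eq {V P : Finset ℕ} {r : ℕ → ℕ}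
    (h : ∀ y ∈ V, ∃ k ∈ P, r k = y) : V.card ≤ P.card :=
  (Finset.card_le_card fun y hy => Finset.mem_image.2 (h y hy)).trans Finset.card_image_le

theorem le_of_antitone_steps {r : ℕ → ℕ} {a b : ℕ} (h : ∀ i, a ≤ i → i < b → r (i + 1) ≤ r i)
    {i j : ℕ} (hi : a ≤ i) (hij : i ≤ j) (hj : j ≤ b) : r j ≤ r i := by
  induction j, hij using Nat.le_induction with
  | base => exact le_rfl
  | succ j hij ih => exact (h j (by omega) (by omega)).trans (ih (by omega))

/-- The amount by which the non-maximal ranks `r k` are shifted upwards. -/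
theorem exists_shift {m J a b : ℕ} {r : ℕ → ℕ} (hsurj : ∀ y ≤ J, ∃ k ≤ m, r k = y)
    (hr : ∀ k ≤ m, r k ≤ J) (hab : a ≤ b) (hbm : b ≤ m) (hra : r a = J) (hrb : r b = J)
    (hlt_a : ∀ k < a, r k ≠ J) (hlt_b : ∀ k, b < k → k ≤ m → r k ≠ J) :
    ∃ t, t + J ≤ m ∧
      (∀ k, a = k + 1 → (∀ i < k, r (i + 1) ≤ r i) → r k + t + a ≤ m) ∧
      (b < m → (∀ i, b < i → i < m → r (i + 1) ≤ r i) →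
        r m + t ≤ 1 ∨ m + 1 ≤ r (b + 1) + t + b) := by
  have hJ : J ≤ m := by
    have := card_le_of_forall_exists_eq (V := Finset.range (J + 1)) (P := Finset.range (m + 1))
      (r := r) (fun y hy => by
        obtain ⟨k, hk, h⟩ := hsurj y (by simpa [Nat.lt_succ_iff] using hy)
        exact ⟨k, by simpa [Nat.lt_succ_iff] using hk, h⟩)
    simpa using this
  have hpre0 : ∀ k, a = k + 1 → (∀ i < k, r (i + 1) ≤ r i) → r k + a ≤ m := by
    intro k hk hanti
    have hkJ : r k < J := lt_of_le_of_ne (hr k (by omega)) (hlt_a k (by omega))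
    have := card_le_of_forall_exists_eq (V := insert J (Finset.range (r k)))
      (P := Finset.Icc a m) (r := r) (fun y hy => by
        rcases Finset.mem_insert.1 hy with rfl | hy
        · exact ⟨a, by simp; omega, hra⟩
        · have hy := Finset.mem_range.1 hy
          obtain ⟨i, hi, h⟩ := hsurj y (by omega)
          refine ⟨i, Finset.mem_Icc.2 ⟨?_, hi⟩, h⟩
          by_contra! hia
          have := le_of_antitone_steps (a := 0) (b := k) (fun i _ => hanti i) (Nat.zero_le i)
            (show i ≤ k by omega) le_rfl
          omega)
    rw [Finset.card_insert_of_notMem (by simp; omega)] at this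
    simp at this
    omega
  by_cases hc : b < m ∧ (∀ i, b < i → i < m → r (i + 1) ≤ r i) ∧ 2 ≤ r m
  · obtain ⟨hb, hanti, h2⟩ := hc
    have hsuf : ∀ i, b < i → i ≤ m → r i ≤ r (b + 1) ∧ r m ≤ r i := fun i h h' =>
      ⟨le_of_antitone_steps (a := b + 1) (b := m) hanti le_rfl h h',
        le_of_antitone_steps (a := b + 1) (b := m) hanti h h' le_rfl⟩
    have hbJ : r (b + 1) < J := lt_of_le_of_ne (hr _ hb) (hlt_b _ (by omega) hb)
    have hbm' := (hsuf m hb le_rfl).1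
    refine ⟨m + 1 - (r (b + 1) + b), ?_, ?_, fun _ _ => Or.inr (by omega)⟩
    · have := card_le_of_forall_exists_eq
        (V := Finset.range 2 ∪ Finset.Icc (r (b + 1) + 1) J)
        (P := Finset.range (b + 1)) (r := r) (fun y hy => by
          simp only [Finset.mem_union, Finset.mem_range, Finset.mem_Icc] at hy
          obtain ⟨i, hi, h⟩ := hsurj y (by omega)
          refine ⟨i, Finset.mem_range.2 ?_, h⟩
          by_contra! hib
          have := hsuf i (by omega) hi
          omega)
      rw [Finset.card_union_of_disjoint] at this
      · simp at this
        omega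
      · rw [Finset.disjoint_left]
        simp
        omega
    · intro k hk hanti'
      have hpre := hpre0 k hk hanti'
      have hkJ : r k < J := lt_of_le_of_ne (hr k (by omega)) (hlt_a k (by omega))
      have hinit : ∀ i < a, r k ≤ r i := fun i hi =>
        le_of_antitone_steps (a := 0) (b := k) (fun i _ => hanti' i) (Nat.zero_le i)
          (show i ≤ k by omega) le_rfl
      suffices r k + 1 + a ≤ r (b + 1) + b by omega
      rcases Nat.lt_or_ge (r k) 2 with hk2 | hk2
      · omega
      have := card_le_of_forall_exists_eq
        (V := insert J (Finset.range 2 ∪ Finset.Ico (r (b + 1) + 1) (r k)))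
        (P := Finset.Icc a b) (r := r) (fun y hy => by
          rcases Finset.mem_insert.1 hy with rfl | hy
          · exact ⟨a, Finset.mem_Icc.2 ⟨le_rfl, hab⟩, hra⟩
          simp only [Finset.mem_union, Finset.mem_range, Finset.mem_Ico] at hy
          obtain ⟨i, hi, h⟩ := hsurj y (by omega)
          refine ⟨i, Finset.mem_Icc.2 ⟨?_, ?_⟩, h⟩
          · by_contra! hia
            have := hinit i hia
            omega
          · by_contra! hib
            have := hsuf i hib hi
            omega)
      rw [Finset.card_insert_of_notMem (by simp; omega), Finset.card_union_of_disjoint] at this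
      · simp at this
        omega
      · rw [Finset.disjoint_left]
        simp
        omega
  · refine ⟨0, by omega, by simpa using hpre0, fun h h' => Or.inl ?_⟩
    by_contra! h''
    exact hc ⟨h, h', by omega⟩

/-- Every word of ranks with values exactly `0, …, J` embeds, up to order isomorphism, into the
superpattern word. -/
theorem exists_embedding_of_ranks {m J : ℕ} (hm : 2 ≤ m) {r : ℕ → ℕ}
    (hsurj : ∀ y ≤ J, ∃ k ≤ m, r k = y) (hr : ∀ k ≤ m, r k ≤ J) :
    ∃ g : ℕ → ℕ, (∀ k < m, g k < g (k + 1)) ∧ (∀ k ≤ m, g k ∈ keySet m) ∧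
      ∀ i ≤ m, ∀ j ≤ m, keyLetter m (g i) ≤ keyLetter m (g j) ↔ r i ≤ r j := by
  have hex : ∃ k, k ≤ m ∧ r k = J := hsurj J le_rfl
  obtain ⟨a, ⟨ham, hra⟩, hlt_a⟩ : ∃ a, (a ≤ m ∧ r a = J) ∧ ∀ k < a, r k ≠ J :=
    ⟨Nat.find hex, Nat.find_spec hex, fun k hk h =>
      Nat.find_min hex hk ⟨hk.le.trans (Nat.find_spec hex).1, h⟩⟩
  obtain ⟨b, hab, hbm, hrb, hlt_b⟩ :
      ∃ b, a ≤ b ∧ b ≤ m ∧ r b = J ∧ ∀ k, b < k → k ≤ m → r k ≠ J :=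
    ⟨Nat.findGreatest (fun k => r k = J) m, Nat.le_findGreatest ham hra,
      Nat.findGreatest_le m, Nat.findGreatest_spec (P := fun k => r k = J) ham hra,
      fun k hk hkm => Nat.findGreatest_is_greatest (P := fun k => r k = J) hk hkm⟩
  obtain ⟨t, htJ, hpre, hsuf⟩ := exists_shift hsurj hr hab hbm hra hrb hlt_a hlt_b
  set q : ℕ → ℕ := fun k => if r k = J then m else r k + t
  have hq_top : ∀ k, r k = J → q k = m := fun k h => if_pos h
  have hq_low : ∀ k, r k ≠ J → q k = r k + t := fun k h => if_neg h
  have hq_lt : ∀ k ≤ m, r k ≠ J → q k < m := fun k hk h => by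
    have := lt_of_le_of_ne (hr k hk) h
    rw [hq_low k h]
    omega
  have hq_le : ∀ k ≤ m, q k ≤ m := fun k hk => by
    by_cases h : r k = J
    · exact (hq_top k h).le
    · exact (hq_lt k hk h).le
  have hstep : ∀ k < m, greedyKey m q k < greedyKey m q (k + 1) := fun k hk => by
    refine greedyKey_lt_succ hm hq_le (hq_top a hra)
      (fun i hi => (hq_lt i (by omega) (hlt_a i hi)).ne) (fun i hi hanti => ?_) hk
    rw [hq_low i (hlt_a i (by omega))]
    refine hpre i hi fun l hl => ?_
    have := hanti l hl
    rw [hq_low l (hlt_a l (by omega)), hq_low (l + 1) (hlt_a _ (by omega))] at this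
    omega
  have hlast : greedyKey m q m ≤ 2 * (m * (m - 1) + 1) + 1 := by
    refine greedyKey_last_le hm hq_le (hq_top b hrb) hbm
      (fun k hk hkm => (hq_lt k hkm (hlt_b k hk hkm)).ne) (fun hb hanti h => ?_)
    rw [hq_low (b + 1) (hlt_b _ (by omega) hb)] at h
    rw [hq_low m (hlt_b m hb le_rfl)]
    have := hsuf hb fun i hi him => by
      have := hanti i hi him
      rw [hq_low i (hlt_b i hi him.le), hq_low (i + 1) (hlt_b _ (by omega) him)] at this
      omega
    omega
  have hmono : ∀ k n, k ≤ n → n ≤ m → greedyKey m q k ≤ greedyKey m q n := fun k n hkn => by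
    induction n, hkn using Nat.le_induction with
    | base => exact fun _ => le_rfl
    | succ n _ ih => exact fun h => (ih (by omega)).trans (hstep n h).le
  refine ⟨greedyKey m q, hstep,
    fun k hk => greedyKey_mem_keySet hk ((hmono k m hk le_rfl).trans hlast), fun i hi j hj => ?_⟩
  rw [keyLetter_greedyKey (hq_le i hi), keyLetter_greedyKey (hq_le j hj)]
  have hi' := hr i hi
  have hj' := hr j hj
  by_cases h1 : r i = J <;> by_cases h2 : r j = J
  · rw [hq_top i h1, hq_top j h2]; omega
  · have := hq_lt j hj h2
    rw [hq_top i h1]; omega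
  · have := hq_lt i hi h1
    rw [hq_top j h2]; omega
  · rw [hq_low i h1, hq_low j h2]; omega

/-- Dense ranking of the letters of a nonempty pattern. -/
theorem exists_ranks {m d : ℕ} (p : Fin (m + 1) → Fin d) :
    ∃ (J : ℕ) (r : ℕ → ℕ), (∀ y ≤ J, ∃ k ≤ m, r k = y) ∧ (∀ k ≤ m, r k ≤ J) ∧
      ∀ a b : Fin (m + 1), r a ≤ r b ↔ p a ≤ p b := by
  set I := Finset.univ.image p
  have hmem : ∀ a, p a ∈ I := fun a => Finset.mem_image_of_mem p (Finset.mem_univ a)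
  have hpos : 0 < I.card := Finset.card_pos.2 ⟨_, hmem 0⟩
  set e := I.orderIsoOfFin rfl
  set r : ℕ → ℕ := fun k => e.symm ⟨p (Fin.ofNat (m + 1) k), hmem _⟩ with hr
  have hra : ∀ a : Fin (m + 1), r a = e.symm ⟨p a, hmem a⟩ := fun a => by
    simp [hr]
  refine ⟨I.card - 1, r, fun y hy => ?_, fun k _ => ?_, fun a b => ?_⟩
  · obtain ⟨a, -, ha⟩ := Finset.mem_image.1 (e ⟨y, by omega⟩).2
    refine ⟨a, Nat.lt_succ_iff.1 a.2, ?_⟩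
    rw [hra]
    have : (⟨p a, hmem a⟩ : I) = e ⟨y, by omega⟩ := Subtype.ext ha
    rw [this, OrderIso.symm_apply_apply]
  · exact Nat.le_sub_one_of_lt (Fin.is_lt _)
  · rw [hra, hra, Fin.val_fin_le, OrderIso.le_iff_le, Subtype.mk_le_mk]

/-- For every `d ≥ 3` there is a word of length `d² − 2d + 4` over a `d`-letter
alphabet containing every pattern of length `d`; i.e. `n(d,d) ≤ d² − 2d + 4`. -/
theorem superpattern_length_upper_bound (d : ℕ) (hd : 3 ≤ d) :
    ∃ w : Fin (d ^ 2 - 2 * d + 4) → Fin d, ∀ p : Fin d → Fin d, Contains w p := by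
  obtain ⟨m, rfl⟩ : ∃ m, d = m + 1 := ⟨d - 1, by omega⟩
  have hm : 2 ≤ m := by omega
  have hcard : (keySet m).card = (m + 1) ^ 2 - 2 * (m + 1) + 4 := by
    rw [card_keySet hm]
    obtain ⟨n, rfl⟩ : ∃ n, m = n + 1 := ⟨m - 1, by omega⟩
    have : (n + 1 + 1) ^ 2 = (n + 1) * n + (n + 1) + 3 + 2 * (n + 1 + 1) - 4 := by
      rw [eq_tsub_iff_add_eq_of_le (by omega)]
      ring
    simp only [Nat.add_sub_cancel]
    omega
  set e := (keySet m).orderIsoOfFin hcard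
  refine ⟨fun i => ⟨keyLetter m (e i), Nat.lt_succ_iff.2 (keyLetter_le hm _)⟩, fun p => ?_⟩
  obtain ⟨J, r, hsurj, hr, hrp⟩ := exists_ranks p
  obtain ⟨g, hstep, hmem, hle⟩ := exists_embedding_of_ranks hm hsurj hr
  have hle_m : ∀ a : Fin (m + 1), (a : ℕ) ≤ m := fun a => Nat.lt_succ_iff.1 a.2
  refine ⟨fun a => e.symm ⟨g a, hmem a (hle_m a)⟩, ?_, fun a b => ?_⟩
  · refine Fin.strictMono_iff_lt_succ.2 fun i => ?_
    rw [OrderIso.lt_iff_lt, Subtype.mk_lt_mk]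
    exact hstep i i.2
  · simp only [OrderIso.apply_symm_apply, Fin.mk_le_mk]
    rw [hle a (hle_m a) b (hle_m b), hrp]
end
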